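/- For every u = (u₁,u₂) with u₁ ∈ C⁴(cl B⁵;ℂ), u₂ ∈ C³(cl B⁵;ℂ): Re (L̃u | u) ≤ −‖u‖², where (·|·) := Σ_{i=1}^{5} (·|·)_i and ‖u‖² := (u|u). -/

import Mathlib

open MeasureTheory ComplexConjugate

noncomputable section

abbrev E5 : Type := EuclideanSpace ℝ (Fin 5)

/-- the partial derivative in the `i`-th coordinate direction -/
def pd (i : Fin 5) (f : E5 → ℂ) : E5 → ℂ :=
  fun x => fderiv ℝ f x (EuclideanSpace.single i 1)

/-- the iterated partial derivative `∂^β` for a multi-index `β` -/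
def pdM (β : Fin 5 → ℕ) (f : E5 → ℂ) : E5 → ℂ :=
  (List.finRange 5).foldr (fun i g => (pd i)^[β i] g) f

/-- the Laplacian `Δf = ∑_j ∂_j∂_j f` -/
def lap (f : E5 → ℂ) : E5 → ℂ := fun x => ∑ j : Fin 5, pd j (pd j f) x

/-- the open unit ball `B⁵ ⊆ ℝ⁵` -/
def ball5 : Set E5 := Metric.ball 0 1

/-- the unit sphere `S⁴ = ∂B⁵` -/
def sph4 : Set E5 := Metric.sphere 0 1

/-- the squared `L²` norm over the unit ball -/
def bL2Sq (f : E5 → ℂ) : ℝ := ∫ x in ball5, ‖f x‖ ^ 2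

/-- the squared `H^m(B⁵)` norm: `∑_{|β| ≤ m} ‖∂^β f‖²_{L²(B⁵)}` -/
def HSq (m : ℕ) (f : E5 → ℂ) : ℝ :=
  ∑ β : Fin 5 → Fin (m + 1),
    if (∑ i, (β i : ℕ)) ≤ m then bL2Sq (pdM (fun i => (β i : ℕ)) f) else 0

/-- the sesquilinear form `(u|v)₁` -/
def ip1 (u v : (E5 → ℂ) × (E5 → ℂ)) : ℂ :=
  (∑ i : Fin 5, ∑ j : Fin 5, ∑ k : Fin 5,
      ∫ x in ball5, pd i (pd j (pd k u.1)) x * conj (pd i (pd j (pd k v.1)) x)) +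
    (∑ i : Fin 5, ∑ j : Fin 5,
      ∫ x in ball5, pd i (pd j u.2) x * conj (pd i (pd j v.2) x)) +
    (∑ i : Fin 5, ∑ j : Fin 5,
      ∫ ω in sph4, pd i (pd j u.1) ω * conj (pd i (pd j v.1) ω) ∂μH[4])

/-- the sesquilinear form `(u|v)₂` -/
def ip2 (u v : (E5 → ℂ) × (E5 → ℂ)) : ℂ :=
  (∑ i : Fin 5, ∫ x in ball5, pd i (lap u.1) x * conj (pd i (lap v.1) x)) +
    (∑ i : Fin 5, ∑ j : Fin 5,
      ∫ x in ball5, pd i (pd j u.2) x * conj (pd i (pd j v.2) x)) +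
    (∑ j : Fin 5, ∫ ω in sph4, pd j u.2 ω * conj (pd j v.2 ω) ∂μH[4])

/-- the sesquilinear form `(u|v)₃` -/
def ip3 (u v : (E5 → ℂ) × (E5 → ℂ)) : ℂ :=
  5 * ip1 u v + ip2 u v + ∫ ω in sph4, u.2 ω * conj (v.2 ω) ∂μH[4]

/-- the sesquilinear form `(u|v)₄` -/
def ip4 (u v : (E5 → ℂ) × (E5 → ℂ)) : ℂ :=
  ip1 u v + ip2 u v + ∑ i : Fin 5, ∫ ω in sph4, pd i u.1 ω * conj (pd i v.1 ω) ∂μH[4]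

/-- `ζ(ω, w(ω)) = ω^iω^j ∂_i∂_j w₁(ω) + 5ω^i ∂_i w₁(ω) + 3w₁(ω) + ω^j ∂_j w₂(ω) + 3w₂(ω)` -/
def zeta (w : (E5 → ℂ) × (E5 → ℂ)) (ω : E5) : ℂ :=
  (∑ i : Fin 5, ∑ j : Fin 5, (ω i : ℂ) * (ω j : ℂ) * pd i (pd j w.1) ω) +
    5 * (∑ i : Fin 5, (ω i : ℂ) * pd i w.1 ω) + 3 * w.1 ω +
    (∑ j : Fin 5, (ω j : ℂ) * pd j w.2 ω) + 3 * w.2 ω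

/-- the sesquilinear form `(u|v)₅` -/
def ip5 (u v : (E5 → ℂ) × (E5 → ℂ)) : ℂ :=
  (∫ ω in sph4, zeta u ω ∂μH[4]) * conj (∫ ω in sph4, zeta v ω ∂μH[4])

/-- the full sesquilinear form `(u|v) = ∑_{i=1}^{5} (u|v)_i` -/
def ipT (u v : (E5 → ℂ) × (E5 → ℂ)) : ℂ :=
  ip1 u v + ip2 u v + ip3 u v + ip4 u v + ip5 u v

/-- the free operator `L̃u = (−ξ^j ∂_j u₁ − u₁ + u₂, Δu₁ − ξ^j ∂_j u₂ − 2u₂)` -/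
def Ltil (u : (E5 → ℂ) × (E5 → ℂ)) : (E5 → ℂ) × (E5 → ℂ) :=
  (fun ξ => -(∑ j : Fin 5, (ξ j : ℂ) * pd j u.1 ξ) - u.1 ξ + u.2 ξ,
   fun ξ => lap u.1 ξ - (∑ j : Fin 5, (ξ j : ℂ) * pd j u.2 ξ) - 2 * u.2 ξ)

section pointw

open scoped Pointwise



/-- surface measure on the unit sphere (polar coordinates) pushed to `E5` -/
def sig : Measure E5 := (volume : Measure E5).toSphere.map Subtype.val

lemma finrank_E5 : Module.finrank ℝ E5 = 5 := by simp [E5]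

instance : IsFiniteMeasure sig := by unfold sig; infer_instance

lemma sig_apply {A : Set E5} (hA : MeasurableSet A) :
    sig A = 5 * volume (Set.Ioo (0:ℝ) 1 • (sph4 ∩ A)) := by
  rw [sig, Measure.map_apply measurable_subtype_coe hA,
    Measure.toSphere_apply' _ (measurable_subtype_coe hA), Subtype.image_preimage_coe, finrank_E5]
  rfl

lemma measurableSet_sph4 : MeasurableSet sph4 := Metric.isClosed_sphere.measurableSet

lemma sig_compl : sig sph4ᶜ = 0 := by
  rw [sig_apply measurableSet_sph4.compl]
  simp

lemma sig_restrict : sig.restrict sph4 = sig := by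
  rw [Measure.restrict_eq_self_of_ae_mem]
  exact measure_eq_zero_iff_ae_notMem.1 sig_compl |>.mono (by simp)

lemma sig_map (e : E5 ≃ₗᵢ[ℝ] E5) : sig.map e = sig := by
  ext A hA
  have hm : Measurable e := e.continuous.measurable
  rw [Measure.map_apply hm hA, sig_apply hA, sig_apply (hm hA)]
  congr 1
  have hp := (e.measurePreserving).measure_preimage_emb e.toHomeomorph.measurableEmbedding
    (Set.Ioo (0:ℝ) 1 • (sph4 ∩ A))
  rw [← hp]
  congr 1
  ext x
  simp only [Set.mem_smul, Set.mem_inter_iff, Set.mem_preimage, sph4, mem_sphere_zero_iff_norm]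
  constructor
  · rintro ⟨t, ht, y, ⟨hy, hyA⟩, rfl⟩
    exact ⟨t, ht, e y, ⟨by simpa using hy, hyA⟩, by simp⟩
  · rintro ⟨t, ht, y, ⟨hy, hyA⟩, h⟩
    refine ⟨t, ht, e.symm y, ⟨by simpa using hy, by simpa using hyA⟩, ?_⟩
    apply e.injective
    simpa using h

/-- polar coordinates -/
lemma polar {f : E5 → ℂ} (hf : Continuous f) :
    ∫ x in ball5, f x = ∫ r in (0:ℝ)..1, (r:ℂ)^4 * ∫ ω, f (r • ω) ∂sig := by
  have hIntOn : IntegrableOn f ball5 :=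
    (hf.continuousOn.integrableOn_compact (isCompact_closedBall (0:E5) 1)).mono_set
      Metric.ball_subset_closedBall
  have hmb : MeasurableSet ball5 := measurableSet_ball
  set F : E5 → ℂ := ball5.indicator f with hF
  have hFi : Integrable F := (integrable_indicator_iff hmb).2 hIntOn
  have mp := (volume : Measure E5).measurePreserving_homeomorphUnitSphereProd
  have key : (fun p : Metric.sphere (0:E5) 1 × Set.Ioi (0:ℝ) => F (p.2.1 • p.1.1)) ∘
      (homeomorphUnitSphereProd E5) = fun x : ({0}ᶜ : Set E5) => F x.1 := by
    funext x
    have := congrArg Subtype.val ((homeomorphUnitSphereProd E5).symm_apply_apply x)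
    simp only [Function.comp]
    congr 1
  have h1 : ∫ x in ball5, f x = ∫ x : ({0}ᶜ : Set E5), F x.1 ∂(volume.comap Subtype.val) := by
    rw [integral_subtype_comap (measurableSet_singleton _).compl F,
        restrict_compl_singleton, integral_indicator hmb]
  have h2 : Integrable (fun x : ({0}ᶜ : Set E5) => F x.1) (volume.comap Subtype.val) := by
    have := (integrableOn_iff_comap_subtypeVal (f := F) (μ := volume)
      (measurableSet_singleton (0:E5)).compl).1 hFi.integrableOn
    exact this
  have h3 : Integrable (fun p : Metric.sphere (0:E5) 1 × Set.Ioi (0:ℝ) => F (p.2.1 • p.1.1))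
      ((volume : Measure E5).toSphere.prod (Measure.volumeIoiPow (Module.finrank ℝ E5 - 1))) := by
    rw [← mp.integrable_comp_emb (Homeomorph.measurableEmbedding _), key]
    exact h2
  rw [h1, ← key]
  have h4 := mp.integral_comp (Homeomorph.measurableEmbedding _)
    (fun p : Metric.sphere (0:E5) 1 × Set.Ioi (0:ℝ) => F (p.2.1 • p.1.1))
  simp only [Function.comp_def]
  rw [h4, integral_prod_symm _ h3, finrank_E5]
  simp only [Measure.volumeIoiPow, ENNReal.ofReal]
  rw [integral_withDensity_eq_integral_smul
      ((measurable_subtype_coe.pow_const _).real_toNNReal)]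
  rw [integral_subtype_comap measurableSet_Ioi (fun a : ℝ => Real.toNNReal (a ^ (5-1)) •
    ∫ ω : Metric.sphere (0:E5) 1, F (a • ω.1) ∂(volume : Measure E5).toSphere)]
  rw [intervalIntegral.integral_of_le zero_le_one, integral_Ioc_eq_integral_Ioo]
  rw [setIntegral_eq_of_subset_of_forall_sdiff_eq_zero measurableSet_Ioi
    (s := Set.Ioo (0:ℝ) 1) (fun x hx => hx.1)]
  · refine setIntegral_congr_fun measurableSet_Ioo fun r hr => ?_
    simp only [NNReal.smul_def]
    rw [Real.coe_toNNReal _ (pow_nonneg hr.1.le _), sig,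
      integral_map (f := fun y : E5 => f (r • y)) measurable_subtype_coe.aemeasurable
        (by fun_prop)]
    rw [Complex.real_smul]
    push_cast
    congr 1
    refine integral_congr_ae (.of_forall fun ω => ?_)
    have hω : ‖ω.1‖ = 1 := by simpa using ω.2
    have : r • ω.1 ∈ ball5 := by
      simp [ball5, norm_smul, hω, abs_of_pos hr.1, hr.2]
    simp [hF, this]
  · rintro r ⟨hr, hr'⟩
    have hr1 : 1 ≤ r := by
      by_contra h
      exact hr' ⟨hr, not_le.1 h⟩
    have : ∀ ω : Metric.sphere (0:E5) 1, F (r • ω.1) = 0 := by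
      intro ω
      have hω : ‖ω.1‖ = 1 := by simpa using ω.2
      have : r • ω.1 ∉ ball5 := by
        simp [ball5, norm_smul, hω, abs_of_pos hr.out, hr1]
      simp [hF, this]
    simp [this]


lemma vol4 (R : ℝ) (hR : 0 ≤ R) : volume {z : Fin 4 → ℝ | ∑ i, z i ^ 2 < R ^ 2} =
    ENNReal.ofReal (R ^ 4 * (Real.pi ^ 2 / 2)) := by
  have h := InnerProductSpace.volume_ball_of_dim_even (E := EuclideanSpace ℝ (Fin 4)) (k := 2)
    (by simp) 0 R
  rw [← (PiLp.volume_preserving_toLp (Fin 4)).measure_preimage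
      measurableSet_ball.nullMeasurableSet] at h
  have e : (WithLp.toLp 2 : (Fin 4 → ℝ) → _) ⁻¹' Metric.ball (0 : EuclideanSpace ℝ (Fin 4)) R =
      {z : Fin 4 → ℝ | ∑ i, z i ^ 2 < R ^ 2} := by
    ext z
    simp only [Set.mem_preimage, EuclideanSpace.ball_zero_eq _ hR, Set.mem_ofPred_eq]
  rw [e] at h
  rw [h, finrank_euclideanSpace_fin, ← ENNReal.ofReal_pow hR, ← ENNReal.ofReal_mul (by positivity)]
  norm_num [Nat.factorial]

lemma vol_cone (c k : ℝ) (hc : 0 ≤ c) (hk : 0 ≤ k) :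
    volume {y : E5 | 0 < y 0 ∧ y 0 < c ∧ ∑ i : Fin 4, y i.succ ^ 2 < (k * y 0) ^ 2} =
      ENNReal.ofReal (Real.pi ^ 2 / 2 * k ^ 4 * c ^ 5 / 5) := by
  set T : Set (ℝ × (Fin 4 → ℝ)) :=
    {p | 0 < p.1 ∧ p.1 < c ∧ ∑ i : Fin 4, p.2 i ^ 2 < (k * p.1) ^ 2} with hT
  have hTm : MeasurableSet T := by
    have o1 : IsOpen {p : ℝ × (Fin 4 → ℝ) | 0 < p.1} := isOpen_lt (by fun_prop) (by fun_prop)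
    have o2 : IsOpen {p : ℝ × (Fin 4 → ℝ) | p.1 < c} := isOpen_lt (by fun_prop) (by fun_prop)
    have o3 : IsOpen {p : ℝ × (Fin 4 → ℝ) | ∑ i : Fin 4, p.2 i ^ 2 < (k * p.1) ^ 2} :=
      isOpen_lt (by fun_prop) (by fun_prop)
    exact (o1.inter (o2.inter o3)).measurableSet
  have mp1 := (PiLp.volume_preserving_ofLp (Fin 5))
  have mp2 := volume_preserving_piFinSuccAbove (fun _ : Fin 5 => ℝ) 0
  have mp := mp2.comp mp1
  have e : {y : E5 | 0 < y 0 ∧ y 0 < c ∧ ∑ i : Fin 4, y i.succ ^ 2 < (k * y 0) ^ 2} =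
    (⇑(MeasurableEquiv.piFinSuccAbove (fun _ : Fin 5 => ℝ) 0) ∘ WithLp.ofLp (p := 2)) ⁻¹' T := by
    ext y
    simp [hT, Fin.tail]
  rw [e, mp.measure_preimage hTm.nullMeasurableSet, Measure.volume_eq_prod, Measure.prod_apply hTm]
  have : ∀ t : ℝ, volume (Prod.mk t ⁻¹' T) = (Set.Ioo 0 c).indicator
      (fun t => ENNReal.ofReal ((k * t) ^ 4 * (Real.pi ^ 2 / 2))) t := by
    intro t
    by_cases ht : t ∈ Set.Ioo 0 c
    · rw [Set.indicator_of_mem ht, ← vol4 _ (mul_nonneg hk ht.1.le)]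
      congr 1
      ext z
      simp [hT, ht.1, ht.2]
    · rw [Set.indicator_of_notMem ht]
      have : Prod.mk t ⁻¹' T = ∅ := by
        ext z
        simp only [hT, Set.mem_preimage, Set.mem_ofPred_eq, Set.mem_empty_iff_false, iff_false]
        exact fun h => ht ⟨h.1, h.2.1⟩
      simp [this]
  simp_rw [this]
  rw [lintegral_indicator measurableSet_Ioo, ← ofReal_integral_eq_lintegral_ofReal]
  · congr 1
    rw [← integral_Ioc_eq_integral_Ioo, ← intervalIntegral.integral_of_le hc]
    simp_rw [mul_pow]
    rw [intervalIntegral.integral_mul_const, intervalIntegral.integral_const_mul, integral_pow]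
    norm_num
    ring
  · have : Continuous (fun t : ℝ => (k * t) ^ 4 * (Real.pi ^ 2 / 2)) := by fun_prop
    exact this.integrableOn_Icc.mono_set Set.Ioo_subset_Icc_self
  · exact .of_forall fun t => by positivity

lemma sig_cap0 (r : ℝ) (hr : 0 < r) (hr1 : r ≤ 1/25) :
    ENNReal.ofReal (64/13 * r^4) ≤ sig (Metric.closedBall (EuclideanSpace.single 0 1) r) := by
  set c : ℝ := 1 - r^2/2 with hc
  have hr2 : r^2 ≤ 1/625 := by nlinarith
  have hc0 : 0 < c := by rw [hc]; linarith
  set s : ℝ := Real.sqrt (1 - c^2) with hs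
  have hc1 : c < 1 := by rw [hc]; nlinarith
  have hs2 : s^2 = 1 - c^2 := Real.sq_sqrt (by nlinarith)
  have hs0 : 0 ≤ s := Real.sqrt_nonneg _
  rw [sig_apply Metric.isClosed_closedBall.measurableSet]
  have hsub : {y : E5 | 0 < y 0 ∧ y 0 < c ∧ ∑ i : Fin 4, y i.succ ^ 2 < (s / c * y 0) ^ 2} ⊆
      Set.Ioo (0:ℝ) 1 • (sph4 ∩ Metric.closedBall (EuclideanSpace.single 0 1) r) := by
    rintro y ⟨h0, h1, h2⟩
    have hn : ‖y‖^2 = y 0 ^ 2 + ∑ i : Fin 4, y i.succ ^ 2 := by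
      rw [EuclideanSpace.norm_sq_eq, Fin.sum_univ_succ]
      simp
    have hn2 : c ^ 2 * ‖y‖^2 ≤ y 0 ^ 2 := by
      have e1 : c^2 * (s / c * y 0) ^ 2 = (1 - c^2) * y 0 ^ 2 := by
        rw [← hs2]; field_simp
      rw [hn]
      nlinarith [mul_lt_mul_of_pos_left h2 (pow_pos hc0 2)]
    have hn3 : c * ‖y‖ ≤ y 0 := by
      apply le_of_sq_le_sq _ h0.le
      nlinarith
    have hy0 : 0 < ‖y‖ := by
      rw [norm_pos_iff]; rintro rfl; simp at h0
    have hy1 : ‖y‖ < 1 := by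
      by_contra h
      nlinarith [not_lt.1 h]
    refine ⟨‖y‖, ⟨hy0, hy1⟩, ‖y‖⁻¹ • y, ⟨?_, ?_⟩, ?_⟩
    · simp [sph4, norm_smul, hy0.ne']
    · rw [mem_closedBall_iff_norm]
      apply le_of_sq_le_sq _ hr.le
      rw [norm_sub_sq_real]
      have : inner ℝ (‖y‖⁻¹ • y) (EuclideanSpace.single 0 1 : E5) = ‖y‖⁻¹ * y 0 := by
        rw [inner_smul_left]
        simp [EuclideanSpace.inner_single_right]
      rw [this]
      have h3 : c ≤ ‖y‖⁻¹ * y 0 := by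
        rw [inv_mul_eq_div, le_div_iff₀ hy0]; exact hn3
      simp [norm_smul, hy0.ne']
      nlinarith
    · simp [smul_smul, hy0.ne']
  calc ENNReal.ofReal (64/13 * r^4) ≤ ENNReal.ofReal (5 * (Real.pi ^ 2 / 2 * (s/c) ^ 4 * c ^ 5 / 5)) := by
        apply ENNReal.ofReal_le_ofReal
        have e1 : 5 * (Real.pi ^ 2 / 2 * (s/c) ^ 4 * c ^ 5 / 5) = Real.pi^2/2 * ((s^2)^2 * c) := by
          field_simp
        have e2 : s^2 = r^2 * (1 - r^2/4) := by rw [hs2, hc]; ring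
        rw [e1, e2]
        have hpi : (9.869:ℝ) ≤ Real.pi^2 := by nlinarith [Real.pi_gt_d4]
        have e3 : (0.998:ℝ) ≤ (1 - r^2/4)^2 * c := by
          have a1 : (0.9996:ℝ) ≤ 1 - r^2/4 := by linarith
          have a2 : (0.9992:ℝ) ≤ c := by rw [hc]; linarith
          have a3 : (0.9996:ℝ)^2 ≤ (1 - r^2/4)^2 := by gcongr
          nlinarith
        have e4 : (64/13:ℝ) ≤ Real.pi^2/2 * ((1 - r^2/4)^2 * c) := by nlinarith
        calc 64/13 * r^4 ≤ Real.pi^2/2 * ((1 - r^2/4)^2 * c) * r^4 := by gcongr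
          _ = _ := by ring
    _ = 5 * volume {y : E5 | 0 < y 0 ∧ y 0 < c ∧ ∑ i : Fin 4, y i.succ ^ 2 < (s / c * y 0) ^ 2} := by
        rw [vol_cone c (s/c) hc0.le (by positivity), ENNReal.ofReal_mul (by norm_num)]
        simp
    _ ≤ _ := by gcongr

lemma sig_cap (x : E5) (hx : x ∈ sph4) (r : ℝ) (hr : 0 < r) (hr1 : r ≤ 1/25) :
    ENNReal.ofReal (64/13 * r^4) ≤ sig (Metric.closedBall x r) := by
  refine (sig_cap0 r hr hr1).trans (le_of_eq ?_)
  have hx1 : ‖x‖ = 1 := by simpa [sph4] using hx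
  have hn : ‖x‖ = ‖(EuclideanSpace.single 0 1 : E5)‖ := by simp [hx1]
  have h := Submodule.reflection_sub hn
  set e := (Submodule.reflection (Submodule.span ℝ {x - (EuclideanSpace.single 0 1 : E5)})ᗮ)
  rw [← sig_map e, Measure.map_apply e.continuous.measurable
    Metric.isClosed_closedBall.measurableSet, sig_map, ← h]
  congr 1
  ext y
  simp

lemma ediam_cb (x : E5) (r : ℝ) (hr : 0 ≤ r) :
    Metric.ediam (Metric.closedBall x r) ≤ ENNReal.ofReal (2 * r) := by
  rw [← Metric.closedEBall_ofReal hr, ENNReal.ofReal_mul (by norm_num)]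
  simpa using Metric.ediam_closedEBall_le

lemma hausdorff_le (A : Set E5) (hA : A ⊆ sph4) :
    (μH[4] : Measure E5) A ≤ ENNReal.ofReal (13/4) * sig A := by
  have : ∀ n : ℕ, ∃ (t : Set E5) (r : E5 → ℝ), t.Countable ∧ t ⊆ A ∧
      (∀ x ∈ t, r x ∈ Set.Ioo (0:ℝ) (1/(n+25))) ∧
      (A ⊆ ⋃ x ∈ t, Metric.closedBall x (r x)) ∧
      (∑' x : t, sig (Metric.closedBall x (r x))) ≤ sig A + ENNReal.ofReal (1/(n+1)) := by
    intro n
    apply Besicovitch.exists_closedBall_covering_tsum_measure_le sig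
      (ENNReal.ofReal_pos.2 (by positivity)).ne' (fun _ => Set.Ioo (0:ℝ) (1/(n+25))) A
    intro x _ δ hδ
    rw [Set.Ioo_inter_Ioo, Set.nonempty_Ioo]
    simp only [max_self]
    exact lt_min (by positivity) hδ
  choose t r ht htA hr hcov hsum using this
  have : ∀ n, Countable (t n) := fun n => (ht n).to_subtype
  have hr' : ∀ (n : ℕ) (x : t n), 0 < r n x ∧ r n x ≤ 1/25 ∧ r n x ≤ 1/(n+1) := by
    intro n x
    obtain ⟨h1, h2⟩ := hr n x x.2
    refine ⟨h1, h2.le.trans ?_, h2.le.trans ?_⟩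
    · gcongr; simp
    · gcongr; norm_num
  have h := Measure.hausdorffMeasure_le_liminf_tsum 4 A (l := Filter.atTop)
    (ι := fun n => t n)
    (fun n : ℕ => ENNReal.ofReal (2 * (1/(n+1)))) (by
      have := (tendsto_one_div_add_atTop_nhds_zero_nat (𝕜 := ℝ)).const_mul 2
      have := ENNReal.tendsto_ofReal this
      simpa using this)
    (fun n x => Metric.closedBall x (r n x)) (.of_forall fun n x => by
      refine (ediam_cb _ _ (hr' n x).1.le).trans ?_
      apply ENNReal.ofReal_le_ofReal
      linarith [(hr' n x).2.2]) (.of_forall fun n => by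
      rw [Set.iUnion_coe_set]; exact hcov n)
  refine h.trans ?_
  have h2 : ∀ n : ℕ, ∑' x : t n, Metric.ediam (Metric.closedBall x.1 (r n x)) ^ (4:ℝ) ≤
      ENNReal.ofReal (13/4) * (sig A + ENNReal.ofReal (1/(n+1))) := by
    intro n
    refine le_trans ?_ (mul_le_mul_right (hsum n) _)
    rw [← ENNReal.tsum_mul_left]
    refine ENNReal.tsum_le_tsum fun x => ?_
    obtain ⟨h1, h2, h3⟩ := hr' n x
    calc Metric.ediam (Metric.closedBall x.1 (r n x)) ^ (4:ℝ)
        ≤ (ENNReal.ofReal (2 * r n x)) ^ (4:ℝ) := by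
          gcongr
          exact ediam_cb _ _ h1.le
      _ = ENNReal.ofReal (13/4) * ENNReal.ofReal (64/13 * (r n x)^4) := by
          rw [← ENNReal.ofReal_mul (by norm_num), show (4:ℝ) = ((4:ℕ):ℝ) by norm_num,
            ENNReal.rpow_natCast, ← ENNReal.ofReal_pow (by positivity)]
          congr 1
          push_cast
          ring
      _ ≤ _ := by
          gcongr
          exact sig_cap _ (hA (htA n x.2)) _ h1 h2
  have h3 : Filter.Tendsto (fun n : ℕ => ENNReal.ofReal (13/4) *
      (sig A + ENNReal.ofReal (1/((n:ℝ)+1)))) Filter.atTop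
      (nhds (ENNReal.ofReal (13/4) * sig A)) := by
    have := ENNReal.tendsto_ofReal (tendsto_one_div_add_atTop_nhds_zero_nat (𝕜 := ℝ))
    have := ENNReal.Tendsto.const_mul (a := ENNReal.ofReal (13/4))
      (this.const_add (sig A)) (Or.inr ENNReal.ofReal_ne_top)
    simpa using this
  refine le_trans (Filter.liminf_le_liminf (.of_forall h2)) h3.liminf_eq.le

/-- the Hausdorff measure on the sphere -/
def nu : Measure E5 := (μH[4] : Measure E5).restrict sph4

lemma nu_le : nu ≤ ENNReal.ofReal (13/4) • sig := by
  refine Measure.le_iff.2 fun A hA => ?_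
  rw [nu, Measure.restrict_apply hA, Measure.smul_apply, smul_eq_mul]
  refine (hausdorff_le _ Set.inter_subset_right).trans ?_
  gcongr
  exact Set.inter_subset_left

instance : IsFiniteMeasure nu := by
  refine ⟨lt_of_le_of_lt (nu_le Set.univ) ?_⟩
  rw [Measure.smul_apply, smul_eq_mul]
  exact ENNReal.mul_lt_top ENNReal.ofReal_lt_top (measure_lt_top _ _)

lemma nu_restrict : nu.restrict sph4 = nu := by
  rw [nu, Measure.restrict_restrict measurableSet_sph4, Set.inter_self]

lemma nu_map (e : E5 ≃ₗᵢ[ℝ] E5) : nu.map e = nu := by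
  have h := (e.toIsometryEquiv.measurePreserving_hausdorffMeasure 4).restrict_preimage
    measurableSet_sph4
  have h2 : e.toIsometryEquiv ⁻¹' sph4 = sph4 := by
    ext x; simp [sph4]
  rw [h2] at h
  exact h.map_eq

end pointw


/-! ### partial derivatives -/

lemma fderiv_eq_sum (g : E5 → ℂ) (x v : E5) :
    fderiv ℝ g x v = ∑ j, (v j : ℂ) * pd j g x := by
  have hv : v = ∑ j, v j • (EuclideanSpace.single j (1:ℝ) : E5) := by
    have := (EuclideanSpace.basisFun (Fin 5) ℝ).sum_repr v
    simpa using this.symm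
  conv_lhs => rw [hv]
  rw [map_sum]
  refine Finset.sum_congr rfl fun j _ => ?_
  rw [map_smul, Complex.real_smul]
  rfl

lemma contDiff_coord (j : Fin 5) {n : WithTop ℕ∞} : ContDiff ℝ n (fun x : E5 => (x j : ℂ)) := by
  have : (fun x : E5 => (x j : ℂ)) =
    fun x => (Complex.ofRealCLM.comp (EuclideanSpace.proj j : E5 →L[ℝ] ℝ)) x := by
    ext x; simp
  rw [this]
  exact ContinuousLinearMap.contDiff _

lemma differentiable_coord (j : Fin 5) : Differentiable ℝ (fun x : E5 => (x j : ℂ)) :=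
  (contDiff_coord j (n := 1)).differentiable one_ne_zero

lemma continuous_coord (j : Fin 5) : Continuous (fun x : E5 => (x j : ℂ)) :=
  (differentiable_coord j).continuous

lemma pd_coord (i j : Fin 5) (x : E5) : pd i (fun x : E5 => (x j : ℂ)) x = if i = j then 1 else 0 := by
  have : (fun x : E5 => (x j : ℂ)) =
    fun x => (Complex.ofRealCLM.comp (EuclideanSpace.proj j : E5 →L[ℝ] ℝ)) x := by
    ext x; simp
  rw [pd, this, ContinuousLinearMap.fderiv]
  rcases eq_or_ne i j with h | h
  · subst h; simp
  · simp [h, h.symm]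

lemma pd_add {i : Fin 5} {f g : E5 → ℂ} (hf : Differentiable ℝ f) (hg : Differentiable ℝ g) :
    pd i (fun x => f x + g x) = fun x => pd i f x + pd i g x := by
  funext x
  simp only [pd]
  rw [fderiv_fun_add (hf x) (hg x)]; rfl

lemma pd_sub {i : Fin 5} {f g : E5 → ℂ} (hf : Differentiable ℝ f) (hg : Differentiable ℝ g) :
    pd i (fun x => f x - g x) = fun x => pd i f x - pd i g x := by
  funext x
  simp only [pd]
  rw [fderiv_fun_sub (hf x) (hg x)]; rfl

lemma pd_neg {i : Fin 5} {f : E5 → ℂ} :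
    pd i (fun x => - f x) = fun x => - pd i f x := by
  funext x
  simp only [pd]
  rw [fderiv_fun_neg]; rfl

lemma pd_sum {i : Fin 5} {f : Fin 5 → E5 → ℂ} (hf : ∀ j, Differentiable ℝ (f j)) :
    pd i (fun x => ∑ j, f j x) = fun x => ∑ j, pd i (f j) x := by
  funext x
  simp only [pd]
  rw [fderiv_fun_sum (fun j _ => hf j x)]
  simp

lemma pd_mul {i : Fin 5} {f g : E5 → ℂ} (hf : Differentiable ℝ f) (hg : Differentiable ℝ g) :
    pd i (fun x => f x * g x) = fun x => pd i f x * g x + f x * pd i g x := by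
  funext x
  simp only [pd]
  rw [fderiv_fun_mul (hf x) (hg x)]
  simp
  ring

lemma pd_const_mul {i : Fin 5} (c : ℂ) {f : E5 → ℂ} (hf : Differentiable ℝ f) :
    pd i (fun x => c * f x) = fun x => c * pd i f x := by
  funext x
  simp only [pd]
  rw [fderiv_const_mul (hf x)]
  simp

lemma pd_conj {i : Fin 5} {f : E5 → ℂ} (hf : Differentiable ℝ f) :
    pd i (fun x => conj (f x)) = fun x => conj (pd i f x) := by
  funext x
  simp only [pd]
  have := (Complex.conjCLE.toContinuousLinearMap.hasFDerivAt (x := f x)).comp x (hf x).hasFDerivAt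
  have h2 := this.fderiv
  have e : (Complex.conjCLE.toContinuousLinearMap ∘ f) = fun x => conj (f x) := by
    funext y; simp
  rw [e] at h2
  rw [h2]
  simp

lemma contDiff_conj {f : E5 → ℂ} {n : WithTop ℕ∞} (hf : ContDiff ℝ n f) :
    ContDiff ℝ n (fun x => conj (f x)) :=
  Complex.conjCLE.contDiff.comp hf

lemma contDiff_pd {n : WithTop ℕ∞} {m : WithTop ℕ∞} (i : Fin 5) {f : E5 → ℂ} (hf : ContDiff ℝ n f)
    (h : m + 1 ≤ n) : ContDiff ℝ m (pd i f) :=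
  (hf.fderiv_right h).clm_apply contDiff_const

lemma pd_comp_smul (i : Fin 5) (r : ℝ) {f : E5 → ℂ} (hf : Differentiable ℝ f) (x : E5) :
    pd i (fun x => f (r • x)) x = r * pd i f (r • x) := by
  have h1 : HasFDerivAt (fun x : E5 => r • x) (r • ContinuousLinearMap.id ℝ E5) x :=
    (hasFDerivAt_id x).const_smul r
  have h := (hf (r • x)).hasFDerivAt.comp x h1
  have := h.fderiv
  simp only [pd]
  simp only [Function.comp_def] at this
  rw [this]
  simp

lemma pd_comm {f : E5 → ℂ} (hf : ContDiff ℝ 2 f) (i j : Fin 5) : pd i (pd j f) = pd j (pd i f) := by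
  funext x
  have hd : Differentiable ℝ (fderiv ℝ f) :=
    (hf.fderiv_right (m := 1) (by norm_num)).differentiable one_ne_zero
  have key : ∀ a b : Fin 5, pd a (pd b f) x =
      fderiv ℝ (fderiv ℝ f) x (EuclideanSpace.single a 1) (EuclideanSpace.single b 1) := by
    intro a b
    simp only [pd]
    change fderiv ℝ (fun y => fderiv ℝ f y (EuclideanSpace.single b 1)) x _ = _
    rw [fderiv_clm_apply (hd x) (differentiableAt_const _)]
    simp
  rw [key, key]
  have := (hf.contDiffAt (x := x)).isSymmSndFDerivAt (by simp)
  exact this _ _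

lemma hasDerivAt_curve {g : E5 → ℂ} (hg : Differentiable ℝ g) {γ : ℝ → E5} {v : E5} {t : ℝ}
    (hγ : HasDerivAt γ v t) : HasDerivAt (fun s => g (γ s)) (∑ j, (v j : ℂ) * pd j g (γ t)) t := by
  rw [← fderiv_eq_sum]
  exact (hg (γ t)).hasFDerivAt.comp_hasDerivAt t hγ

/-! ### rotation-invariant measures on the sphere -/

/-- rotation-invariant finite measures on the unit sphere -/
structure Good (μ : Measure E5) : Prop where
  fin : IsFiniteMeasure μ
  supp : μ.restrict sph4 = μ
  inv : ∀ e : E5 ≃ₗᵢ[ℝ] E5, μ.map e = μ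

lemma good_sig : Good sig := ⟨inferInstance, sig_restrict, sig_map⟩
lemma good_nu : Good nu := ⟨inferInstance, nu_restrict, nu_map⟩

lemma isCompact_sph4 : IsCompact sph4 := isCompact_sphere _ _

lemma Good.integrable {F : Type*} [NormedAddCommGroup F] {μ : Measure E5} (h : Good μ) {f : E5 → F}
    (hf : Continuous f) : Integrable f μ := by
  have := h.fin
  have h1 := hf.continuousOn.integrableOn_compact (μ := μ) isCompact_sph4
  rwa [IntegrableOn, h.supp] at h1

lemma Good.congr {F : Type*} [NormedAddCommGroup F] [NormedSpace ℝ F] {μ : Measure E5} (h : Good μ)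
    {f g : E5 → F} (hfg : ∀ x, ‖x‖ = 1 → f x = g x) : ∫ x, f x ∂μ = ∫ x, g x ∂μ := by
  rw [← h.supp]
  exact setIntegral_congr_fun measurableSet_sph4 fun x hx => hfg x (by simpa [sph4] using hx)

lemma Good.comp {μ : Measure E5} (h : Good μ) {f : E5 → ℂ} (e : E5 ≃ₗᵢ[ℝ] E5) :
    ∫ x, f (e x) ∂μ = ∫ x, f x ∂μ := by
  conv_rhs => rw [← h.inv e]
  exact (MeasurableEmbedding.integral_map (μ := μ) e.toHomeomorph.measurableEmbedding f).symm

lemma Good.swap {μ : Measure E5} (h : Good μ) {F : ℝ → E5 → ℂ} (hF : Continuous (Function.uncurry F))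
    {a b : ℝ} (hab : a ≤ b) :
    ∫ t in a..b, ∫ x, F t x ∂μ = ∫ x, (∫ t in a..b, F t x) ∂μ := by
  have := h.fin
  simp_rw [intervalIntegral.integral_of_le hab, ← integral_Icc_eq_integral_Ioc]
  apply integral_integral_swap
  have h1 := hF.continuousOn.integrableOn_compact (μ := (volume : Measure ℝ).prod μ)
    ((isCompact_Icc (a := a) (b := b)).prod isCompact_sph4)
  rwa [IntegrableOn, ← Measure.prod_restrict, h.supp] at h1

/-- rotation in the `(i,j)`-plane -/
def rotFun (i j : Fin 5) (t : ℝ) (x : E5) : E5 :=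
  x + (Real.cos t - 1) • (x i • EuclideanSpace.single i (1:ℝ) + x j • EuclideanSpace.single j (1:ℝ)) +
    Real.sin t • (x i • EuclideanSpace.single j (1:ℝ) - x j • EuclideanSpace.single i (1:ℝ))

def rotLin (i j : Fin 5) (t : ℝ) : E5 →ₗ[ℝ] E5 where
  toFun := rotFun i j t
  map_add' x y := by simp only [rotFun, PiLp.add_apply]; module
  map_smul' c x := by simp only [rotFun, PiLp.smul_apply, smul_eq_mul, RingHom.id_apply]; module

lemma rot_norm {i j : Fin 5} (hij : i ≠ j) (t : ℝ) (x : E5) : ‖rotLin i j t x‖ = ‖x‖ := by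
  have h : ‖rotFun i j t x‖^2 = ‖x‖^2 := by
    rw [EuclideanSpace.norm_sq_eq, EuclideanSpace.norm_sq_eq]
    simp only [Real.norm_eq_abs, sq_abs]
    rw [← Finset.add_sum_erase _ _ (Finset.mem_univ i),
      ← Finset.add_sum_erase (Finset.univ.erase i) _
        (Finset.mem_erase.2 ⟨hij.symm, Finset.mem_univ j⟩),
      ← Finset.add_sum_erase Finset.univ (fun k => x k ^ 2) (Finset.mem_univ i),
      ← Finset.add_sum_erase (Finset.univ.erase i) (fun k => x k ^ 2)
        (Finset.mem_erase.2 ⟨hij.symm, Finset.mem_univ j⟩)]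
    rw [← add_assoc, ← add_assoc]
    congr 1
    · simp [rotFun, hij, hij.symm]
      linear_combination (x i ^ 2 + x j ^ 2) * Real.sin_sq_add_cos_sq t
    · refine Finset.sum_congr rfl fun k hk => ?_
      simp only [Finset.mem_erase] at hk
      simp [rotFun, hk.1, hk.2.1]
  exact (sq_eq_sq₀ (norm_nonneg _) (norm_nonneg _)).1 h

def rot {i j : Fin 5} (hij : i ≠ j) (t : ℝ) : E5 ≃ₗᵢ[ℝ] E5 :=
  LinearIsometry.toLinearIsometryEquiv ⟨rotLin i j t, rot_norm hij t⟩ rfl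

lemma rot_apply {i j : Fin 5} (hij : i ≠ j) (t : ℝ) (x : E5) : rot hij t x = rotFun i j t x := rfl

lemma rot_deriv {i j : Fin 5} (hij : i ≠ j) (t : ℝ) (x : E5) :
    HasDerivAt (fun s => rotFun i j s x)
      ((rotFun i j t x i) • EuclideanSpace.single j (1:ℝ) -
        (rotFun i j t x j) • EuclideanSpace.single i (1:ℝ)) t := by
  have h1 := ((Real.hasDerivAt_cos t).sub_const 1).smul_const
    (x i • (EuclideanSpace.single i (1:ℝ) : E5) + x j • (EuclideanSpace.single j (1:ℝ) : E5))
  have h2 := (Real.hasDerivAt_sin t).smul_const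
    (x i • (EuclideanSpace.single j (1:ℝ) : E5) - x j • (EuclideanSpace.single i (1:ℝ) : E5))
  have h := (h1.const_add x).add h2
  convert! h using 1
  simp [rotFun, hij, hij.symm]
  module

/-- integrals of rotational derivatives vanish -/
lemma Good.vanish {μ : Measure E5} (h : Good μ) {g : E5 → ℂ} (hg : ContDiff ℝ 1 g) (i j : Fin 5) :
    ∫ x, ((x i : ℂ) * pd j g x - (x j : ℂ) * pd i g x) ∂μ = 0 := by
  by_cases hij : i = j
  · subst hij; simp
  have hcp : ∀ k, Continuous (pd k g) := fun k => (contDiff_pd k hg (m := 0) (by norm_num)).continuous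
  set X : E5 → ℂ := fun x => (x i : ℂ) * pd j g x - (x j : ℂ) * pd i g x with hX
  have hXc : Continuous X := by
    have := continuous_coord i
    have := continuous_coord j
    have := hcp i
    have := hcp j
    fun_prop
  have hrc : Continuous (Function.uncurry (rotFun i j)) := by
    unfold rotFun Function.uncurry
    fun_prop
  have hsw := h.swap (F := fun t x => X (rotFun i j t x)) (hXc.comp hrc) (a := 0) (b := 2 * Real.pi)
    (by positivity)
  have h1 : ∀ t, ∫ x, X (rotFun i j t x) ∂μ = ∫ x, X x ∂μ := fun t => h.comp (rot hij t)
  have h2 : ∀ x, ∫ t in (0:ℝ)..(2 * Real.pi), X (rotFun i j t x) = 0 := by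
    intro x
    have hd : ∀ t ∈ Set.uIcc 0 (2 * Real.pi),
        HasDerivAt (fun s => g (rotFun i j s x)) (X (rotFun i j t x)) t := by
      intro t _
      have := hasDerivAt_curve (hg.differentiable one_ne_zero) (rot_deriv hij t x)
      convert! this using 1
      simp [hX, sub_mul, Finset.sum_sub_distrib, apply_ite Complex.ofReal, ite_mul]
    rw [intervalIntegral.integral_eq_sub_of_hasDerivAt hd]
    · simp [rotFun]
    · apply Continuous.intervalIntegrable
      exact hXc.comp (hrc.comp (by fun_prop : Continuous fun t : ℝ => (t, x)))
  simp only [h1, h2] at hsw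
  simpa [Real.pi_ne_zero] using hsw


/-- the radial derivative `ξ^j ∂_j f` -/
def Lam (f : E5 → ℂ) : E5 → ℂ := fun x => ∑ j : Fin 5, (x j : ℂ) * pd j f x

/-- the model expression `-Λ f - m f + g` -/
def WW (f : E5 → ℂ) (m : ℂ) (g : E5 → ℂ) : E5 → ℂ := fun x => -Lam f x - m * f x + g x

lemma cpd {f : E5 → ℂ} (hf : ContDiff ℝ 1 f) (i : Fin 5) : Continuous (pd i f) :=
  (contDiff_pd i hf (m := 0) (by norm_num)).continuous

lemma contDiff_Lam {n m : WithTop ℕ∞} {f : E5 → ℂ} (hf : ContDiff ℝ n f) (h : m + 1 ≤ n) :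
    ContDiff ℝ m (Lam f) :=
  ContDiff.sum fun j _ => (contDiff_coord j).mul (contDiff_pd j hf h)

lemma continuous_Lam {f : E5 → ℂ} (hf : ContDiff ℝ 1 f) : Continuous (Lam f) :=
  (contDiff_Lam hf (m := 0) (by norm_num)).continuous

lemma continuous_WW {f g : E5 → ℂ} (hf : ContDiff ℝ 1 f) (m : ℂ) (hg : Continuous g) :
    Continuous (WW f m g) := by
  have := continuous_Lam hf
  have := hf.continuous
  unfold WW
  fun_prop

lemma contDiff_lap {n m : WithTop ℕ∞} {f : E5 → ℂ} (hf : ContDiff ℝ n f) (h : m + 1 + 1 ≤ n) :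
    ContDiff ℝ m (lap f) :=
  ContDiff.sum fun j _ => contDiff_pd j (contDiff_pd j hf h) le_rfl

lemma pd_Lam {f : E5 → ℂ} (hf : ContDiff ℝ 2 f) (i : Fin 5) :
    pd i (Lam f) = fun x => Lam (pd i f) x + pd i f x := by
  have hd : ∀ j, Differentiable ℝ (pd j f) := fun j =>
    (contDiff_pd j hf (m := 1) (by norm_num)).differentiable one_ne_zero
  unfold Lam
  rw [pd_sum (f := fun j x => (x j : ℂ) * pd j f x)
    (fun j => (differentiable_coord j).mul (hd j))]
  funext x
  simp only [pd_mul (differentiable_coord _) (hd _), pd_coord, Finset.sum_add_distrib, ite_mul,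
    one_mul, zero_mul, Finset.sum_ite_eq, Finset.mem_univ, if_true]
  rw [add_comm]
  congr 1
  refine Finset.sum_congr rfl fun j _ => ?_
  rw [pd_comm hf]

lemma pd_WW {f g : E5 → ℂ} (hf : ContDiff ℝ 2 f) (m : ℂ) (hg : ContDiff ℝ 1 g) (i : Fin 5) :
    pd i (WW f m g) = WW (pd i f) (m + 1) (pd i g) := by
  have h1 : Differentiable ℝ (Lam f) :=
    (contDiff_Lam hf (m := 1) (by norm_num)).differentiable one_ne_zero
  have h2 : Differentiable ℝ f := hf.differentiable two_ne_zero
  have h3 : Differentiable ℝ g := hg.differentiable one_ne_zero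
  unfold WW
  rw [pd_add ((h1.fun_neg).fun_sub (h2.const_mul m)) h3, pd_sub h1.fun_neg (h2.const_mul m), pd_neg,
    pd_const_mul m h2, pd_Lam hf]
  funext x
  ring

lemma lap_comm {f : E5 → ℂ} (hf : ContDiff ℝ 3 f) (i : Fin 5) : pd i (lap f) = lap (pd i f) := by
  have h1 : ∀ j, ContDiff ℝ 2 (pd j f) := fun j => contDiff_pd j hf (by norm_num)
  have h2 : ∀ j, Differentiable ℝ (pd j (pd j f)) := fun j =>
    (contDiff_pd j (h1 j) (m := 1) (by norm_num)).differentiable one_ne_zero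
  unfold lap
  rw [pd_sum (f := fun j x => pd j (pd j f) x) h2]
  funext x
  refine Finset.sum_congr rfl fun j _ => ?_
  rw [pd_comm (h1 j) i j, pd_comm (hf.of_le (by norm_num)) i j]

lemma Lam_lap {f : E5 → ℂ} (hf : ContDiff ℝ 3 f) (x : E5) :
    Lam (lap f) x = ∑ j, Lam (pd j (pd j f)) x := by
  have h1 : ∀ j, ContDiff ℝ 2 (pd j f) := fun j => contDiff_pd j hf (by norm_num)
  have h2 : ∀ j, Differentiable ℝ (pd j (pd j f)) := fun j =>
    (contDiff_pd j (h1 j) (m := 1) (by norm_num)).differentiable one_ne_zero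
  unfold Lam lap
  simp only [pd_sum (f := fun j x => pd j (pd j f) x) h2, Finset.mul_sum]
  exact Finset.sum_comm

lemma lap_WW {f g : E5 → ℂ} (hf : ContDiff ℝ 3 f) (m : ℂ) (hg : ContDiff ℝ 2 g) :
    lap (WW f m g) = WW (lap f) (m + 2) (lap g) := by
  have h1 : ∀ j, ContDiff ℝ 2 (pd j f) := fun j => contDiff_pd j hf (by norm_num)
  have h2 : ∀ j, ContDiff ℝ 1 (pd j g) := fun j => contDiff_pd j hg (by norm_num)
  funext x
  simp only [lap, pd_WW (hf.of_le (by norm_num)) m (hg.of_le (by norm_num)), pd_WW (h1 _) _ (h2 _)]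
  have := Lam_lap hf x
  simp only [WW, this, lap, Finset.sum_add_distrib, Finset.sum_sub_distrib, Finset.sum_neg_distrib,
    ← Finset.mul_sum]
  ring

lemma sum_sq_coord {x : E5} (hx : ‖x‖ = 1) : ∑ j, (x j : ℂ) * (x j : ℂ) = 1 := by
  have := EuclideanSpace.norm_sq_eq x
  rw [hx] at this
  simp only [Real.norm_eq_abs, sq_abs] at this
  have h2 : ((∑ j, x j ^ 2 : ℝ) : ℂ) = 1 := by rw [← this]; norm_num
  push_cast at h2
  simpa [sq] using h2

/-- tangential integration by parts -/
lemma Good.tang {μ : Measure E5} (h : Good μ) {f : E5 → ℂ} (hf : ContDiff ℝ 1 f) (i : Fin 5) (r : ℝ) :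
    ∫ x, (r : ℂ) * pd i f (r • x) ∂μ =
      ∫ x, ((r : ℂ) * ((x i : ℂ) * ∑ j, (x j : ℂ) * pd j f (r • x)) + 4 * ((x i : ℂ) * f (r • x))) ∂μ := by
  have hfr : ContDiff ℝ 1 (fun x : E5 => f (r • x)) := hf.comp (contDiff_const_smul r)
  have hfd := hf.differentiable one_ne_zero
  have hg : ∀ j : Fin 5, ContDiff ℝ 1 (fun x : E5 => (x j : ℂ) * f (r • x)) :=
    fun j => (contDiff_coord j).mul hfr
  have hc : ∀ j : Fin 5, Continuous (fun x : E5 => pd j f (r • x)) := fun j => by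
    have := cpd hf j
    fun_prop
  have hco := continuous_coord
  have hv : ∫ x, ∑ j : Fin 5, ((x j : ℂ) * pd i (fun x : E5 => (x j : ℂ) * f (r • x)) x -
      (x i : ℂ) * pd j (fun x : E5 => (x j : ℂ) * f (r • x)) x) ∂μ = 0 := by
    rw [integral_finsetSum]
    · exact Finset.sum_eq_zero fun j _ => h.vanish (hg j) j i
    · intro j _
      have := cpd (hg j) i
      have := cpd (hg j) j
      exact h.integrable (by fun_prop)
  have hfc := hf.continuous
  rw [← sub_eq_zero, ← integral_sub (h.integrable (by fun_prop)) (h.integrable (by fun_prop)), ← hv]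
  refine h.congr fun x hx => ?_
  simp only [pd_mul (differentiable_coord _) (hfr.differentiable one_ne_zero), pd_coord,
    pd_comp_smul _ r hfd, if_true]
  have e1 : ∀ j : Fin 5, (x j : ℂ) * ((if i = j then 1 else 0) * f (r • x) + (x j : ℂ) * (r * pd i f (r • x)))
      - (x i : ℂ) * (1 * f (r • x) + (x j : ℂ) * (r * pd j f (r • x))) =
      (if i = j then (x j : ℂ) * f (r • x) else 0) + ((x j : ℂ) * (x j : ℂ)) * (r * pd i f (r • x))
      - (x i : ℂ) * f (r • x) - (r * x i) * ((x j : ℂ) * pd j f (r • x)) := by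
    intro j
    by_cases hij : i = j <;> simp [hij] <;> ring
  simp only [e1, Finset.sum_sub_distrib, Finset.sum_add_distrib, ← Finset.sum_mul, sum_sq_coord hx,
    Finset.sum_ite_eq, Finset.mem_univ, if_true, ← Finset.mul_sum, Finset.sum_const,
    Finset.card_univ, Fintype.card_fin, nsmul_eq_mul]
  push_cast
  ring

/-- divergence theorem on the ball -/
lemma divB {f : E5 → ℂ} (hf : ContDiff ℝ 1 f) (i : Fin 5) :
    ∫ x in ball5, pd i f x = ∫ x, (x i : ℂ) * f x ∂sig := by
  have hco := continuous_coord
  have hfc := hf.continuous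
  have hcp := cpd hf
  have hfd := hf.differentiable one_ne_zero
  rw [polar (cpd hf i)]
  set F : ℝ → E5 → ℂ := fun r x => (r : ℂ)^3 * ((r : ℂ) * ((x i : ℂ) *
    ∑ j, (x j : ℂ) * pd j f (r • x)) + 4 * ((x i : ℂ) * f (r • x))) with hF
  have hFc : Continuous (Function.uncurry F) := by
    have : ∀ j : Fin 5, Continuous (fun p : ℝ × E5 => (p.2 j : ℂ)) :=
      fun j => (hco j).comp continuous_snd
    have := fun j => (hcp j).comp (by fun_prop : Continuous (fun p : ℝ × E5 => p.1 • p.2))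
    simp only [Function.comp_def] at this
    simp only [hF, Function.uncurry_def]
    fun_prop
  have h1 : ∀ r : ℝ, (r : ℂ)^4 * ∫ x, pd i f (r • x) ∂sig = ∫ x, F r x ∂sig := by
    intro r
    have := good_sig.tang hf i r
    simp only [hF]
    rw [integral_const_mul, ← this, integral_const_mul]
    ring
  simp only [h1]
  rw [good_sig.swap hFc zero_le_one]
  refine good_sig.congr fun x hx => ?_
  have hd : ∀ r ∈ Set.uIcc (0:ℝ) 1, HasDerivAt (fun r : ℝ => (r : ℂ)^4 * ((x i : ℂ) * f (r • x)))
      (F r x) r := by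
    intro r _
    have hγ : HasDerivAt (fun s : ℝ => s • x) x r := by
      simpa using (hasDerivAt_id r).smul_const x
    have h2 := hasDerivAt_curve hfd hγ
    have h3 : HasDerivAt (fun r : ℝ => (r : ℂ)^4) (4 * (r:ℂ)^3) r := by
      have := (hasDerivAt_pow 4 (r : ℂ)).comp_ofReal
      simpa using this
    have := h3.mul (h2.const_mul (x i : ℂ))
    convert! this using 1
    simp only [hF]
    ring
  rw [intervalIntegral.integral_eq_sub_of_hasDerivAt hd]
  · simp
  · apply Continuous.intervalIntegrable
    have hh : Continuous (fun t : ℝ => Function.uncurry F (t, x)) := hFc.comp (by fun_prop)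
    exact hh

lemma intB {F : Type*} [NormedAddCommGroup F] {f : E5 → F} (hf : Continuous f) :
    IntegrableOn f ball5 :=
  (hf.continuousOn.integrableOn_compact (isCompact_closedBall (0:E5) 1)).mono_set
      Metric.ball_subset_closedBall

/-- Green formula -/
lemma green {F G : E5 → ℂ} (hF : ContDiff ℝ 2 F) (hG : ContDiff ℝ 1 G) :
    (∑ i, ∫ x in ball5, pd i F x * conj (pd i G x)) + ∫ x in ball5, lap F x * conj (G x) =
      ∫ x, Lam F x * conj (G x) ∂sig := by
  have h1 : ∀ i, ContDiff ℝ 1 (pd i F) := fun i => contDiff_pd i hF (by norm_num)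
  have hGc := contDiff_conj hG
  have hcG := hGc.continuous
  have hd1 := fun i => (h1 i).differentiable one_ne_zero
  have hd2 := hGc.differentiable one_ne_zero
  have hc1 := fun i => (h1 i).continuous
  have hc2 : ∀ i, Continuous (fun x => conj (pd i G x)) :=
    fun i => Complex.continuous_conj.comp (cpd hG i)
  have hc3 := fun i => cpd (h1 i) i
  have hco := continuous_coord
  have key : ∀ i, (∫ x in ball5, pd i F x * conj (pd i G x)) +
      ∫ x in ball5, pd i (pd i F) x * conj (G x) = ∫ x, (x i : ℂ) * (pd i F x * conj (G x)) ∂sig := by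
    intro i
    rw [← divB ((h1 i).mul hGc) i, ← integral_add (intB (by fun_prop))
      (intB (by fun_prop))]
    congr 1
    funext x
    rw [pd_mul (hd1 i) hd2, pd_conj (hG.differentiable one_ne_zero)]
    ring
  have e1 : ∫ x in ball5, lap F x * conj (G x) =
      ∑ i, ∫ x in ball5, pd i (pd i F) x * conj (G x) := by
    rw [← integral_finsetSum _ (fun i _ => (intB (by fun_prop)))]
    simp only [lap, Finset.sum_mul]
  have e2 : ∫ x, Lam F x * conj (G x) ∂sig =
      ∑ i, ∫ x, (x i : ℂ) * (pd i F x * conj (G x)) ∂sig := by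
    rw [← integral_finsetSum _ (fun i _ =>
      (good_sig.integrable (by fun_prop)))]
    simp only [Lam, Finset.sum_mul, mul_assoc]
  rw [e1, e2, ← Finset.sum_add_distrib]
  exact Finset.sum_congr rfl fun i _ => key i

lemma rad {f : E5 → ℂ} (hf : ContDiff ℝ 1 f) :
    2 * (∫ x in ball5, Lam f x * conj (f x)).re =
      (∫ x, f x * conj (f x) ∂sig).re - 5 * (∫ x in ball5, f x * conj (f x)).re := by
  have hfc := contDiff_conj hf
  have hd := hf.differentiable one_ne_zero
  have hdc := hfc.differentiable one_ne_zero
  have hcf := hf.continuous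
  have hcc := hfc.continuous
  have hco := continuous_coord
  have hcp := cpd hf
  have hcL := continuous_Lam hf
  have hm : ContDiff ℝ 1 (fun x => f x * conj (f x)) := hf.mul hfc
  have key : ∀ i, ∫ x in ball5, pd i (fun x : E5 => (x i : ℂ) * (f x * conj (f x))) x =
      ∫ x, (x i : ℂ) * ((x i : ℂ) * (f x * conj (f x))) ∂sig := fun i =>
    divB ((contDiff_coord i).mul hm) i
  have e2 : ∑ i, ∫ x, (x i : ℂ) * ((x i : ℂ) * (f x * conj (f x))) ∂sig =
      ∫ x, f x * conj (f x) ∂sig := by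
    rw [← integral_finsetSum _ (fun i _ => (good_sig.integrable (by fun_prop)))]
    refine good_sig.congr fun x hx => ?_
    simp only [← mul_assoc, ← Finset.sum_mul, sum_sq_coord hx, one_mul]
  have e1 : ∑ i, ∫ x in ball5, pd i (fun x : E5 => (x i : ℂ) * (f x * conj (f x))) x =
      5 * (∫ x in ball5, f x * conj (f x)) + (∫ x in ball5, Lam f x * conj (f x)) +
        conj (∫ x in ball5, Lam f x * conj (f x)) := by
    rw [← integral_conj, ← integral_const_mul, ← integral_add (intB (by fun_prop)) (intB (by fun_prop)),
      ← integral_add (intB (by fun_prop)) (intB (by fun_prop)), ← integral_finsetSum]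
    · congr 1
      funext x
      simp only [pd_mul (differentiable_coord _) (hd.fun_mul hdc), pd_mul hd hdc, pd_coord, pd_conj hd,
        Lam, map_mul, map_sum, Complex.conj_conj, Complex.conj_ofReal, if_true, one_mul,
        Finset.sum_add_distrib, Finset.sum_const, Finset.card_univ, Fintype.card_fin, nsmul_eq_mul,
        Finset.sum_mul, mul_add]
      push_cast
      rw [add_assoc]
      congr 2 <;> refine Finset.sum_congr rfl fun j _ => by ring
    · intro i _
      exact intB (cpd ((contDiff_coord i).mul hm) i)
  have h := congrArg Complex.re (e1.symm.trans ((Finset.sum_congr rfl fun i _ => key i).trans e2))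
  simp at h
  linarith


lemma re_int {μ : Measure E5} {f : E5 → ℂ} (hf : Integrable f μ) :
    (∫ x, f x ∂μ).re = ∫ x, (f x).re ∂μ := by
  have := Complex.reCLM.integral_comp_comm hf
  simpa using this.symm

lemma re_mul_conj_self (z : ℂ) : (z * conj z).re = ‖z‖ ^ 2 := by
  rw [Complex.mul_conj']
  norm_cast

lemma Good.mono {μ : Measure E5} (h : Good μ) {f g : E5 → ℝ} (hf : Continuous f) (hg : Continuous g)
    (hfg : ∀ x, ‖x‖ = 1 → f x ≤ g x) : ∫ x, f x ∂μ ≤ ∫ x, g x ∂μ := by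
  have h1 := h.integrable hf
  have h2 := h.integrable hg
  rw [← h.supp] at h1 h2 ⊢
  exact setIntegral_mono_on h1 h2 measurableSet_sph4 fun x hx => hfg x (by simpa [sph4] using hx)

lemma nu_int_le {f : E5 → ℝ} (hf : Continuous f) (h0 : ∀ x, 0 ≤ f x) :
    ∫ x, f x ∂nu ≤ 13 / 4 * ∫ x, f x ∂sig := by
  have h1 : ∫ x, f x ∂nu ≤ ∫ x, f x ∂(ENNReal.ofReal (13/4) • sig) := by
    refine integral_mono_measure nu_le (Filter.Eventually.of_forall h0) ?_
    exact (good_sig.integrable hf).smul_measure ENNReal.ofReal_ne_top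
  rw [integral_smul_measure, ENNReal.toReal_ofReal (by norm_num)] at h1
  simpa using h1

lemma Lam_sq_le {x : E5} (hx : ‖x‖ = 1) (p : Fin 5 → ℂ) :
    ‖∑ j, (x j : ℂ) * p j‖ ^ 2 ≤ ∑ j, ‖p j‖ ^ 2 := by
  have h1 : ‖∑ j, (x j : ℂ) * p j‖ ≤ ∑ j, |x j| * ‖p j‖ := by
    refine (norm_sum_le _ _).trans (le_of_eq ?_)
    simp
  have h2 := Finset.sum_mul_sq_le_sq_mul_sq Finset.univ (fun j => |x j|) (fun j => ‖p j‖)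
  have h3 := EuclideanSpace.norm_sq_eq x
  simp only [hx, Real.norm_eq_abs, sq_abs] at h3 h2
  rw [← h3] at h2
  have := pow_le_pow_left₀ (norm_nonneg _) h1 2
  linarith

lemma bulk {f g : E5 → ℂ} (hf : ContDiff ℝ 1 f) (m : ℂ) (hg : Continuous g) :
    ∫ x in ball5, WW f m g x * conj (f x) =
      -(∫ x in ball5, Lam f x * conj (f x)) - m * (∫ x in ball5, f x * conj (f x)) +
        ∫ x in ball5, g x * conj (f x) := by
  have h1 := continuous_Lam hf
  have h2 := hf.continuous
  have h3 := Complex.continuous_conj.comp h2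
  simp only [Function.comp_def] at h3
  rw [← integral_neg, ← integral_const_mul, ← integral_sub (intB (by fun_prop)) (intB (by fun_prop)),
    ← integral_add (intB (by fun_prop)) (intB (by fun_prop))]
  congr 1
  funext x
  simp only [WW]
  ring

lemma key {F G : E5 → ℂ} (hF : ContDiff ℝ 2 F) (hG : ContDiff ℝ 1 G) :
    ((∑ i, ∫ x in ball5, WW (pd i F) 4 (pd i G) x * conj (pd i F x)).re +
      (∫ x in ball5, WW G 4 (lap F) x * conj (G x)).re + (∫ x, WW F 3 G x * conj (F x) ∂nu).re) +
    ((∑ i, ∫ x in ball5, pd i F x * conj (pd i F x)).re +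
      (∫ x in ball5, G x * conj (G x)).re + (∫ x, F x * conj (F x) ∂nu).re)
      ≤ -(3 / 8) * ∫ x, ‖F x‖ ^ 2 ∂nu := by
  have h1 : ∀ i, ContDiff ℝ 1 (pd i F) := fun i => contDiff_pd i hF (by norm_num)
  have hF1 : ContDiff ℝ 1 F := hF.of_le (by norm_num)
  have cL := continuous_Lam hF1
  have cF := hF.continuous
  have cG := hG.continuous
  have cp := cpd hF1
  have cW := continuous_WW hF1 3 cG
  have clap : Continuous (lap F) := (contDiff_lap hF (m := 0) (by norm_num)).continuous
  have cconj : ∀ {f : E5 → ℂ}, Continuous f → Continuous (fun x => conj (f x)) :=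
    fun h => Complex.continuous_conj.comp h
  have ccF := cconj cF
  have ccG := cconj cG
  have ccp := fun i => cconj (cp i)
  have nonneg : ∀ f : E5 → ℂ, Continuous f → 0 ≤ (∫ x in ball5, f x * conj (f x)).re := by
    intro f hf
    have := cconj hf
    rw [re_int (intB (by fun_prop))]
    exact integral_nonneg fun x => by rw [re_mul_conj_self]; positivity
  -- bulk identities
  have b1 : ∀ i, (∫ x in ball5, WW (pd i F) 4 (pd i G) x * conj (pd i F x)).re
      + (∫ x in ball5, pd i F x * conj (pd i F x)).re
      ≤ -(1/2) * (∫ x, pd i F x * conj (pd i F x) ∂sig).re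
        + (∫ x in ball5, pd i F x * conj (pd i G x)).re := by
    intro i
    have e : (∫ x in ball5, pd i G x * conj (pd i F x)).re =
        (∫ x in ball5, pd i F x * conj (pd i G x)).re := by
      rw [← Complex.conj_re, ← integral_conj]
      congr 2
      funext x
      simp [mul_comm]
    rw [bulk (h1 i) 4 (cpd hG i)]
    have := rad (h1 i)
    have := nonneg _ (cp i)
    simp at *
    linarith
  have b2 : (∫ x in ball5, WW G 4 (lap F) x * conj (G x)).re + (∫ x in ball5, G x * conj (G x)).re
      ≤ -(1/2) * (∫ x, G x * conj (G x) ∂sig).re + (∫ x in ball5, lap F x * conj (G x)).re := by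
    rw [bulk hG 4 clap]
    have := rad hG
    have := nonneg _ cG
    simp at *
    linarith
  have gr := congrArg Complex.re (green hF hG)
  rw [Complex.add_re, Complex.re_sum] at gr
  have b1s := Finset.sum_le_sum (fun i (_ : i ∈ Finset.univ) => b1 i)
  simp only [Finset.sum_add_distrib, ← Finset.mul_sum] at b1s
  -- sphere part
  have s1 : -(1/2) * (∑ i, (∫ x, pd i F x * conj (pd i F x) ∂sig).re)
      -(1/2) * (∫ x, G x * conj (G x) ∂sig).re + (∫ x, Lam F x * conj (G x) ∂sig).re
      ≤ -(1/2) * ∫ x, ‖Lam F x - G x‖ ^ 2 ∂sig := by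
    rw [re_int (good_sig.integrable (by fun_prop)), re_int (good_sig.integrable (by fun_prop)),
      Finset.sum_congr rfl (fun i _ => re_int (good_sig.integrable (by fun_prop))),
      ← integral_finsetSum _ (fun i _ => good_sig.integrable (by fun_prop)),
      ← integral_const_mul, ← integral_const_mul, ← integral_const_mul,
      ← integral_sub (good_sig.integrable (by fun_prop)) (good_sig.integrable (by fun_prop)),
      ← integral_add (good_sig.integrable (by fun_prop)) (good_sig.integrable (by fun_prop))]
    refine good_sig.mono (by fun_prop) (by fun_prop) fun x hx => ?_
    simp only [re_mul_conj_self]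
    have h := Lam_sq_le hx (fun j => pd j F x)
    change ‖Lam F x‖ ^ 2 ≤ _ at h
    have h2 : ‖Lam F x - G x‖ ^ 2 = ‖Lam F x‖^2 + ‖G x‖^2 - 2 * (Lam F x * conj (G x)).re := by
      rw [← re_mul_conj_self, ← re_mul_conj_self, ← re_mul_conj_self]
      simp
      ring
    linarith
  have s2 : ∫ x, ‖Lam F x - G x‖ ^ 2 ∂nu ≤ 13 / 4 * ∫ x, ‖Lam F x - G x‖ ^ 2 ∂sig :=
    nu_int_le (by fun_prop) fun x => by positivity
  have s3 : (∫ x, WW F 3 G x * conj (F x) ∂nu).re + (∫ x, F x * conj (F x) ∂nu).re +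
      (3/8) * ∫ x, ‖F x‖ ^ 2 ∂nu ≤ (2/13) * ∫ x, ‖Lam F x - G x‖ ^ 2 ∂nu := by
    rw [re_int (good_nu.integrable (by fun_prop)), re_int (good_nu.integrable (by fun_prop)),
      ← integral_const_mul, ← integral_const_mul,
      ← integral_add (good_nu.integrable (by fun_prop)) (good_nu.integrable (by fun_prop)),
      ← integral_add (good_nu.integrable (by fun_prop)) (good_nu.integrable (by fun_prop))]
    refine good_nu.mono (by fun_prop) (by fun_prop) fun x hx => ?_
    have h2 : (2/13) * ‖Lam F x - G x + (13/4:ℝ) • F x‖ ^ 2 = (2/13) * ‖Lam F x - G x‖^2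
        - (WW F 3 G x * conj (F x)).re - (F x * conj (F x)).re - (3/8) * ‖F x‖ ^ 2 := by
      simp only [Complex.sq_norm, Complex.normSq_apply, WW, Complex.add_re, Complex.add_im,
        Complex.sub_re, Complex.sub_im, Complex.neg_re, Complex.neg_im, Complex.mul_re, Complex.mul_im,
        Complex.smul_re, Complex.smul_im, Complex.conj_re, Complex.conj_im, smul_eq_mul,
        Complex.re_ofNat, Complex.im_ofNat]
      ring
    have : 0 ≤ (2/13) * ‖Lam F x - G x + (13/4:ℝ) • F x‖ ^ 2 := by positivity
    linarith
  rw [Complex.re_sum, Complex.re_sum]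
  linarith


lemma re_le_amgm (z w : ℂ) (t s : ℝ) (ht : 0 < t) (hs : 4 * t * s = 1) :
    (z * conj w).re ≤ t * ‖w‖ ^ 2 + s * ‖z‖ ^ 2 := by
  have h1 : (z * conj w).re ≤ ‖z‖ * ‖w‖ := by
    have := Complex.re_le_norm (z * conj w)
    simpa using this
  obtain rfl : s = 1 / (4 * t) := by
    field_simp
    linarith
  have h2 : t * ‖w‖ ^ 2 + 1 / (4 * t) * ‖z‖ ^ 2 - ‖z‖ * ‖w‖ = (2 * t * ‖w‖ - ‖z‖) ^ 2 / (4 * t) := by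
    field_simp
    ring
  have : 0 ≤ (2 * t * ‖w‖ - ‖z‖) ^ 2 / (4 * t) := by positivity
  linarith

lemma pointwise {x : E5} (hx : ‖x‖ = 1) (D : Fin 5 → Fin 5 → ℂ) (g p : Fin 5 → ℂ) (h : ℂ) :
    -(21/8) * (∑ j, ∑ k, ‖D j k‖ ^ 2) - (9/8) * (∑ j, ‖g j‖ ^ 2)
      + (((-(∑ j, (x j : ℂ) * g j) - 2 * h + ∑ j, D j j) * conj h).re + ‖h‖ ^ 2)
      + ∑ i, (((-(∑ j, (x j : ℂ) * D j i) - 2 * p i + g i) * conj (p i)).re + ‖p i‖ ^ 2) ≤ 0 := by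
  have hA := Lam_sq_le hx g
  have hC : ∀ i, ‖∑ j, (x j : ℂ) * D j i‖ ^ 2 ≤ ∑ j, ‖D j i‖ ^ 2 :=
    fun i => Lam_sq_le hx (fun j => D j i)
  have hB : ‖∑ j, D j j‖ ^ 2 ≤ 5 * ∑ j, ∑ k, ‖D j k‖ ^ 2 := by
    have h1 : ‖∑ j, D j j‖ ≤ ∑ j, ‖D j j‖ := norm_sum_le _ _
    have h2 := sq_sum_le_card_mul_sum_sq (s := Finset.univ) (f := fun j => ‖D j j‖)
    have h3 : ∑ j, ‖D j j‖ ^ 2 ≤ ∑ j, ∑ k, ‖D j k‖ ^ 2 :=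
      Finset.sum_le_sum fun j _ =>
        Finset.single_le_sum (f := fun k => ‖D j k‖ ^ 2) (fun k _ => by positivity) (Finset.mem_univ j)
    have h4 := pow_le_pow_left₀ (norm_nonneg _) h1 2
    simp at h2
    linarith
  have a1 := re_le_amgm (-(∑ j, (x j : ℂ) * g j)) h (7/20) (5/7) (by norm_num) (by norm_num)
  have a2 := re_le_amgm (∑ j, D j j) h (13/20) (5/13) (by norm_num) (by norm_num)
  rw [norm_neg] at a1
  have e1 : ((-(∑ j, (x j : ℂ) * g j) - 2 * h + ∑ j, D j j) * conj h).re =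
      ((-(∑ j, (x j : ℂ) * g j)) * conj h).re - 2 * ‖h‖ ^ 2 + ((∑ j, D j j) * conj h).re := by
    rw [← re_mul_conj_self, add_mul, sub_mul, Complex.add_re, Complex.sub_re, mul_assoc]
    congr 2
    simp
  have e2 : ∑ i, (((-(∑ j, (x j : ℂ) * D j i) - 2 * p i + g i) * conj (p i)).re + ‖p i‖ ^ 2) ≤
      ∑ i, ((2/3) * (∑ j, ‖D j i‖ ^ 2) + (2/5) * ‖g i‖ ^ 2) := by
    refine Finset.sum_le_sum fun i _ => ?_
    have b1 := re_le_amgm (-(∑ j, (x j : ℂ) * D j i)) (p i) (3/8) (2/3) (by norm_num) (by norm_num)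
    have b2 := re_le_amgm (g i) (p i) (5/8) (2/5) (by norm_num) (by norm_num)
    rw [norm_neg] at b1
    have e1 : ((-(∑ j, (x j : ℂ) * D j i) - 2 * p i + g i) * conj (p i)).re =
      ((-(∑ j, (x j : ℂ) * D j i)) * conj (p i)).re - 2 * ‖p i‖ ^ 2 + (g i * conj (p i)).re := by
      rw [← re_mul_conj_self, add_mul, sub_mul, Complex.add_re, Complex.sub_re, mul_assoc]
      congr 2
      simp
    have := hC i
    rw [e1]
    linarith
  have e3 : ∑ i, ((2/3) * (∑ j, ‖D j i‖ ^ 2) + (2/5) * ‖g i‖ ^ 2) =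
      (2/3) * (∑ j, ∑ k, ‖D j k‖ ^ 2) + (2/5) * ∑ i, ‖g i‖ ^ 2 := by
    rw [Finset.sum_add_distrib, ← Finset.mul_sum, ← Finset.mul_sum, Finset.sum_comm]
  rw [e3] at e2
  have n1 : 0 ≤ ∑ j, ∑ k, ‖D j k‖ ^ 2 := by positivity
  have n2 : 0 ≤ ∑ j, ‖g j‖ ^ 2 := by positivity
  rw [e1]
  linarith

/-! ### derivatives of `Ltil u` -/

lemma Ltil_eq (u : (E5 → ℂ) × (E5 → ℂ)) : Ltil u = (WW u.1 1 u.2, WW u.2 2 (lap u.1)) := by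
  unfold Ltil WW Lam
  ext x
  · simp
  · simp only
    ring


lemma d1 {u1 u2 : E5 → ℂ} (h1 : ContDiff ℝ 4 u1) (h2 : ContDiff ℝ 3 u2) (i : Fin 5) : pd i (WW u1 1 u2) = WW (pd i u1) 2 (pd i u2) := by
  rw [pd_WW (h1.of_le (by norm_num)) _ (h2.of_le (by norm_num))]
  norm_num

lemma d2 {u1 u2 : E5 → ℂ} (h1 : ContDiff ℝ 4 u1) (h2 : ContDiff ℝ 3 u2) (i j : Fin 5) : pd i (pd j (WW u1 1 u2)) = WW (pd i (pd j u1)) 3 (pd i (pd j u2)) := by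
  rw [d1 h1 h2, pd_WW (contDiff_pd j h1 (by norm_num)) _ (contDiff_pd j h2 (by norm_num))]
  norm_num

lemma d3 {u1 u2 : E5 → ℂ} (h1 : ContDiff ℝ 4 u1) (h2 : ContDiff ℝ 3 u2) (i j k : Fin 5) : pd i (pd j (pd k (WW u1 1 u2))) =
    WW (pd i (pd j (pd k u1))) 4 (pd i (pd j (pd k u2))) := by
  rw [d2 h1 h2, pd_WW (contDiff_pd j (contDiff_pd k h1 (m := 3) (by norm_num)) (by norm_num)) _
    (contDiff_pd j (contDiff_pd k h2 (m := 2) (by norm_num)) (by norm_num))]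
  norm_num

lemma c1 {u1 u2 : E5 → ℂ} (h1 : ContDiff ℝ 4 u1) (h2 : ContDiff ℝ 3 u2) (i : Fin 5) : pd i (WW u2 2 (lap u1)) = WW (pd i u2) 3 (pd i (lap u1)) := by
  rw [pd_WW (h2.of_le (by norm_num)) _ (contDiff_lap h1 (by norm_num))]
  norm_num

lemma c2 {u1 u2 : E5 → ℂ} (h1 : ContDiff ℝ 4 u1) (h2 : ContDiff ℝ 3 u2) (i j : Fin 5) : pd i (pd j (WW u2 2 (lap u1))) =
    WW (pd i (pd j u2)) 4 (pd i (pd j (lap u1))) := by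
  rw [c1 h1 h2, pd_WW (contDiff_pd j h2 (by norm_num)) _
    (contDiff_pd j (contDiff_lap h1 (m := 2) (by norm_num)) (by norm_num))]
  norm_num

lemma c3 {u1 u2 : E5 → ℂ} (h1 : ContDiff ℝ 4 u1) (h2 : ContDiff ℝ 3 u2) (i : Fin 5) : pd i (lap (WW u1 1 u2)) = WW (pd i (lap u1)) 4 (lap (pd i u2)) := by
  rw [lap_WW (h1.of_le (by norm_num)) _ (h2.of_le (by norm_num)),
    pd_WW (contDiff_lap h1 (by norm_num)) _ (contDiff_lap h2 (by norm_num)), lap_comm h2]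
  norm_num



lemma lap_comm2 {f : E5 → ℂ} (hf : ContDiff ℝ 4 f) (i j : Fin 5) :
    pd i (pd j (lap f)) = lap (pd i (pd j f)) := by
  rw [lap_comm (hf.of_le (by norm_num)), lap_comm (contDiff_pd j hf (by norm_num))]

lemma ip1_eq (w v : (E5 → ℂ) × (E5 → ℂ)) : ip1 w v = ∑ j, ∑ k,
    ((∑ i, ∫ x in ball5, pd i (pd j (pd k w.1)) x * conj (pd i (pd j (pd k v.1)) x)) +
      (∫ x in ball5, pd j (pd k w.2) x * conj (pd j (pd k v.2) x)) +
      ∫ x, pd j (pd k w.1) x * conj (pd j (pd k v.1) x) ∂nu) := by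
  simp only [Finset.sum_add_distrib]
  unfold ip1
  congr 2
  rw [Finset.sum_comm]
  exact Finset.sum_congr rfl fun j _ => Finset.sum_comm

lemma ip2_eq (w v : (E5 → ℂ) × (E5 → ℂ)) : ip2 w v = ∑ j,
    ((∑ i, ∫ x in ball5, pd i (pd j w.2) x * conj (pd i (pd j v.2) x)) +
      (∫ x in ball5, pd j (lap w.1) x * conj (pd j (lap v.1) x)) +
      ∫ x, pd j w.2 x * conj (pd j v.2 x) ∂nu) := by
  simp only [Finset.sum_add_distrib]
  unfold ip2
  congr 1
  rw [add_comm]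
  congr 1
  exact Finset.sum_comm

lemma ip1_le {u1 u2 : E5 → ℂ} (h1 : ContDiff ℝ 4 u1) (h2 : ContDiff ℝ 3 u2) :
    (ip1 (WW u1 1 u2, WW u2 2 (lap u1)) (u1, u2)).re + (ip1 (u1, u2) (u1, u2)).re ≤
      -(3 / 8) * ∑ j, ∑ k, ∫ x, ‖pd j (pd k u1) x‖ ^ 2 ∂nu := by
  rw [ip1_eq, ip1_eq]
  simp only [d3 h1 h2]
  simp only [d2 h1 h2, c2 h1 h2, lap_comm2 h1]
  simp only [Complex.re_sum, Complex.add_re, Finset.mul_sum, ← Finset.sum_add_distrib]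
  refine Finset.sum_le_sum fun j _ => Finset.sum_le_sum fun k _ => ?_
  have := key (contDiff_pd j (contDiff_pd k h1 (m := 3) (by norm_num)) (m := 2) (by norm_num))
    (contDiff_pd j (contDiff_pd k h2 (m := 2) (by norm_num)) (m := 1) (by norm_num))
  simpa only [Complex.re_sum, Complex.add_re, Finset.mul_sum, ← Finset.sum_add_distrib] using this

lemma ip2_le {u1 u2 : E5 → ℂ} (h1 : ContDiff ℝ 4 u1) (h2 : ContDiff ℝ 3 u2) :
    (ip2 (WW u1 1 u2, WW u2 2 (lap u1)) (u1, u2)).re + (ip2 (u1, u2) (u1, u2)).re ≤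
      -(3 / 8) * ∑ j, ∫ x, ‖pd j u2 x‖ ^ 2 ∂nu := by
  rw [ip2_eq, ip2_eq]
  simp only [c2 h1 h2]
  simp only [c3 h1 h2, c1 h1 h2]
  simp only [Complex.re_sum, Complex.add_re, Finset.mul_sum, ← Finset.sum_add_distrib]
  refine Finset.sum_le_sum fun j _ => ?_
  have := key (contDiff_pd j h2 (m := 2) (by norm_num))
    (contDiff_pd j (contDiff_lap h1 (m := 2) (by norm_num)) (m := 1) (by norm_num))
  simpa only [Complex.re_sum, Complex.add_re, Finset.mul_sum, ← Finset.sum_add_distrib] using this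

/-! ### the rank-one part -/

/-- second radial derivative -/
def N2 (f : E5 → ℂ) : E5 → ℂ :=
  fun x => ∑ i : Fin 5, ∑ j : Fin 5, (x i : ℂ) * (x j : ℂ) * pd i (pd j f) x

lemma continuous_N2 {f : E5 → ℂ} (hf : ContDiff ℝ 2 f) : Continuous (N2 f) := by
  have hco := continuous_coord
  have hc : ∀ i j, Continuous (pd i (pd j f)) := fun i j =>
    cpd (contDiff_pd j hf (m := 1) (by norm_num)) i
  unfold N2
  fun_prop

lemma lap_int {f : E5 → ℂ} (hf : ContDiff ℝ 2 f) :
    ∫ x, lap f x ∂nu = ∫ x, (N2 f x + 4 * Lam f x) ∂nu := by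
  have hco := continuous_coord
  have h1 : ∀ i, ContDiff ℝ 1 (pd i f) := fun i => contDiff_pd i hf (by norm_num)
  have hc1 := fun i => (h1 i).continuous
  have hc2 := fun i j => cpd (h1 j) i
  have e1 : ∫ x, lap f x ∂nu = ∑ i, ∫ x, pd i (pd i f) x ∂nu := by
    rw [← integral_finsetSum _ (fun i _ => good_nu.integrable (by fun_prop))]
    rfl
  have e2 : ∫ x, (N2 f x + 4 * Lam f x) ∂nu =
      ∑ i, ∫ x, ((x i : ℂ) * (∑ j, (x j : ℂ) * pd j (pd i f) x) + 4 * ((x i : ℂ) * pd i f x)) ∂nu := by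
    rw [← integral_finsetSum _ (fun i _ => good_nu.integrable (by fun_prop))]
    congr 1
    funext x
    simp only [N2, Lam, Finset.sum_add_distrib, ← Finset.mul_sum]
    congr 1
    rw [Finset.sum_comm]
    simp only [Finset.mul_sum]
    refine Finset.sum_congr rfl fun i _ => Finset.sum_congr rfl fun j _ => ?_
    ring
  rw [e1, e2]
  refine Finset.sum_congr rfl fun i _ => ?_
  have := good_nu.tang (h1 i) i 1
  simpa using this

lemma zeta_int {u1 u2 : E5 → ℂ} (h1 : ContDiff ℝ 4 u1) (h2 : ContDiff ℝ 3 u2) :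
    ∫ x, zeta (WW u1 1 u2, WW u2 2 (lap u1)) x ∂nu = -∫ x, zeta (u1, u2) x ∂nu := by
  have hco := continuous_coord
  have g1 : ∀ i, ContDiff ℝ 3 (pd i u1) := fun i => contDiff_pd i h1 (by norm_num)
  have g2 : ∀ i j, ContDiff ℝ 2 (pd i (pd j u1)) := fun i j => contDiff_pd i (g1 j) (by norm_num)
  have k1 : ContDiff ℝ 2 (lap u1) := contDiff_lap h1 (by norm_num)
  have hL : ContDiff ℝ 3 (Lam u1) := contDiff_Lam h1 (by norm_num)
  have hA := lap_int (h1.of_le (by norm_num) : ContDiff ℝ 2 u1)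
  have hB := lap_int (hL.of_le (by norm_num) : ContDiff ℝ 2 (Lam u1))
  have p1 : ∀ i, pd i (Lam u1) = fun x => Lam (pd i u1) x + pd i u1 x :=
    fun i => pd_Lam (h1.of_le (by norm_num)) i
  have p2 : ∀ i j, pd i (pd j (Lam u1)) = fun x => Lam (pd i (pd j u1)) x + 2 * pd i (pd j u1) x := by
    intro i j
    have hd : Differentiable ℝ (Lam (pd j u1)) :=
      (contDiff_Lam (g1 j) (m := 2) (by norm_num)).differentiable two_ne_zero
    rw [p1, pd_add hd ((g1 j).differentiable (by norm_num)), pd_Lam ((g1 j).of_le (by norm_num))]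
    funext x
    ring
  set N3 : E5 → ℂ := fun x => ∑ i : Fin 5, ∑ j : Fin 5,
    (x i : ℂ) * (x j : ℂ) * Lam (pd i (pd j u1)) x with hN3
  have q0 : ∀ f : E5 → ℂ, ∀ x : E5, ∑ i, (x i : ℂ) * Lam (pd i f) x = N2 f x := by
    intro f x
    simp only [Lam, N2, Finset.mul_sum]
    rw [Finset.sum_comm]
    refine Finset.sum_congr rfl fun i _ => Finset.sum_congr rfl fun j _ => ?_
    ring
  have q1 : ∀ x, lap (Lam u1) x = Lam (lap u1) x + 2 * lap u1 x := by
    intro x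
    rw [Lam_lap (h1.of_le (by norm_num))]
    simp only [lap, p2, Finset.sum_add_distrib, Finset.mul_sum]
  have q2 : ∀ x, N2 (Lam u1) x = N3 x + 2 * N2 u1 x := by
    intro x
    simp only [N2, hN3, p2, mul_add, Finset.sum_add_distrib, Finset.mul_sum]
    congr 1
    refine Finset.sum_congr rfl fun i _ => Finset.sum_congr rfl fun j _ => ?_
    ring
  have q3 : ∀ x, Lam (Lam u1) x = N2 u1 x + Lam u1 x := by
    intro x
    rw [← q0]
    conv_lhs => unfold Lam
    change ∑ j, (x j : ℂ) * pd j (Lam u1) x = _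
    simp only [p1, mul_add, Finset.sum_add_distrib]
    rfl
  have cN2 := continuous_N2 (h1.of_le (by norm_num) : ContDiff ℝ 2 u1)
  have cN2' := continuous_N2 (h2.of_le (by norm_num) : ContDiff ℝ 2 u2)
  have cN3 : Continuous N3 := by
    have := fun i j => continuous_Lam ((g2 i j).of_le (by norm_num))
    fun_prop
  have cL := hL.continuous
  have cL2 := continuous_Lam (h2.of_le (by norm_num) : ContDiff ℝ 1 u2)
  have cl := k1.continuous
  have cLl := continuous_Lam (k1.of_le (by norm_num))
  have cu1 := h1.continuous
  have cu2 := h2.continuous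
  have z1 : ∀ x, zeta (WW u1 1 u2, WW u2 2 (lap u1)) x = -N3 x - 8 * N2 u1 x - 13 * Lam u1 x
      - Lam u2 x + Lam (lap u1) x + 3 * lap u1 x - 3 * u1 x - 3 * u2 x := by
    intro x
    have t1 : ∑ i, ∑ j, (x i : ℂ) * (x j : ℂ) * pd i (pd j (WW u1 1 u2)) x =
        -N3 x - 3 * N2 u1 x + N2 u2 x := by
      simp only [d2 h1 h2, WW, hN3, N2, Finset.mul_sum, ← Finset.sum_sub_distrib,
        ← Finset.sum_add_distrib, ← Finset.sum_neg_distrib]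
      refine Finset.sum_congr rfl fun i _ => Finset.sum_congr rfl fun j _ => ?_
      ring
    have t2 : ∑ i, (x i : ℂ) * pd i (WW u1 1 u2) x = - N2 u1 x - 2 * Lam u1 x + Lam u2 x := by
      rw [← q0]
      conv_rhs => enter [1, 2]; unfold Lam
      conv_rhs => enter [2]; unfold Lam
      simp only [d1 h1 h2, WW, Finset.mul_sum, ← Finset.sum_sub_distrib,
        ← Finset.sum_add_distrib, ← Finset.sum_neg_distrib]
      refine Finset.sum_congr rfl fun i _ => ?_
      ring
    have t3 : ∑ i, (x i : ℂ) * pd i (WW u2 2 (lap u1)) x =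
        - N2 u2 x - 3 * Lam u2 x + Lam (lap u1) x := by
      rw [← q0]
      conv_rhs => enter [1, 2]; unfold Lam
      conv_rhs => enter [2]; unfold Lam
      simp only [c1 h1 h2, WW, Finset.mul_sum, ← Finset.sum_sub_distrib,
        ← Finset.sum_add_distrib, ← Finset.sum_neg_distrib]
      refine Finset.sum_congr rfl fun i _ => ?_
      ring
    simp only [zeta, t1, t2, t3]
    simp only [WW]
    ring
  have z2 : ∀ x, zeta (u1, u2) x = N2 u1 x + 5 * Lam u1 x + 3 * u1 x + Lam u2 x + 3 * u2 x :=
    fun x => rfl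
  simp only [q1, q2, q3] at hB
  have I : ∀ {f : E5 → ℂ}, Continuous f → Integrable f nu := fun h => good_nu.integrable h
  rw [← sub_eq_zero, ← integral_sub (I (by fun_prop)) (I (by fun_prop))] at hA hB
  rw [← sub_eq_zero, sub_neg_eq_add]
  simp only [z1, z2]
  rw [← integral_add (I (by fun_prop)) (I (by fun_prop))]
  have := congrArg₂ (· + ·) hA hB
  rw [← integral_add (I (by fun_prop)) (I (by fun_prop)), add_zero] at this
  rw [← this]
  congr 1
  funext x
  ring

lemma sphere_int {D : Fin 5 → Fin 5 → E5 → ℂ} {g p W : Fin 5 → E5 → ℂ} {h w : E5 → ℂ}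
    (cD : ∀ i j, Continuous (D i j)) (cg : ∀ i, Continuous (g i)) (cp : ∀ i, Continuous (p i))
    (cW : ∀ i, Continuous (W i)) (ch : Continuous h) (cw : Continuous w)
    (hpt : ∀ x : E5, ‖x‖ = 1 → -(21/8) * (∑ j, ∑ k, ‖D j k x‖ ^ 2) - (9/8) * (∑ j, ‖g j x‖ ^ 2)
      + ((w x * conj (h x)).re + ‖h x‖ ^ 2)
      + ∑ i, ((W i x * conj (p i x)).re + ‖p i x‖ ^ 2) ≤ 0) :
    -(21/8) * (∑ j, ∑ k, ∫ x, ‖D j k x‖ ^ 2 ∂nu)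
      - (9/8) * (∑ j, ∫ x, ‖g j x‖ ^ 2 ∂nu)
      + ((∫ x, w x * conj (h x) ∂nu).re + (∫ x, h x * conj (h x) ∂nu).re)
      + ∑ i, ((∫ x, W i x * conj (p i x) ∂nu).re + (∫ x, p i x * conj (p i x) ∂nu).re) ≤ 0 := by
  have I : ∀ {f : E5 → ℂ}, Continuous f → Integrable f nu := fun h => good_nu.integrable h
  have J : ∀ {f : E5 → ℝ}, Continuous f → Integrable f nu := fun h => good_nu.integrable h
  have cch : Continuous (fun x => conj (h x)) := Complex.continuous_conj.comp ch
  have ccp : ∀ i, Continuous (fun x => conj (p i x)) := fun i => Complex.continuous_conj.comp (cp i)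
  have r1 : ∀ i, (∫ x, W i x * conj (p i x) ∂nu).re + (∫ x, p i x * conj (p i x) ∂nu).re =
      ∫ x, ((W i x * conj (p i x)).re + ‖p i x‖ ^ 2) ∂nu := by
    intro i
    rw [re_int (I (by fun_prop)), re_int (I (by fun_prop))]
    simp only [re_mul_conj_self]
    rw [← integral_add (J (by fun_prop)) (J (by fun_prop))]
  have r0 : (∫ x, w x * conj (h x) ∂nu).re + (∫ x, h x * conj (h x) ∂nu).re =
      ∫ x, ((w x * conj (h x)).re + ‖h x‖ ^ 2) ∂nu := by
    rw [re_int (I (by fun_prop)), re_int (I (by fun_prop))]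
    simp only [re_mul_conj_self]
    rw [← integral_add (J (by fun_prop)) (J (by fun_prop))]
  have r2 : ∑ j, ∑ k, ∫ x, ‖D j k x‖ ^ 2 ∂nu = ∫ x, ∑ j, ∑ k, ‖D j k x‖ ^ 2 ∂nu := by
    rw [integral_finsetSum _ (fun i _ => J (by fun_prop))]
    refine Finset.sum_congr rfl fun j _ => ?_
    rw [integral_finsetSum _ (fun i _ => J (by fun_prop))]
  have r3 : ∑ j, ∫ x, ‖g j x‖ ^ 2 ∂nu = ∫ x, ∑ j, ‖g j x‖ ^ 2 ∂nu := by
    rw [integral_finsetSum _ (fun i _ => J (by fun_prop))]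
  have r4 : ∑ i, ((∫ x, W i x * conj (p i x) ∂nu).re + (∫ x, p i x * conj (p i x) ∂nu).re) =
      ∫ x, ∑ i, ((W i x * conj (p i x)).re + ‖p i x‖ ^ 2) ∂nu := by
    rw [integral_finsetSum _ (fun i _ => J (by fun_prop))]
    exact Finset.sum_congr rfl fun i _ => r1 i
  rw [r0, r2, r3, r4, ← integral_const_mul, ← integral_const_mul,
    ← integral_sub (J (by fun_prop)) (J (by fun_prop)),
    ← integral_add (J (by fun_prop)) (J (by fun_prop)),
    ← integral_add (J (by fun_prop)) (J (by fun_prop))]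
  have h0 : (0:ℝ) = ∫ x : E5, (0:ℝ) ∂nu := by simp
  rw [h0]
  exact good_nu.mono (by fun_prop) (by fun_prop) hpt

lemma final {u1 u2 : E5 → ℂ} (h1 : ContDiff ℝ 4 u1) (h2 : ContDiff ℝ 3 u2) :
    (ipT (WW u1 1 u2, WW u2 2 (lap u1)) (u1, u2)).re ≤ -(ipT (u1, u2) (u1, u2)).re := by
  have a1 := ip1_le h1 h2
  have a2 := ip2_le h1 h2
  have g1 : ∀ i, ContDiff ℝ 3 (pd i u1) := fun i => contDiff_pd i h1 (by norm_num)
  have g2 : ∀ i j, ContDiff ℝ 2 (pd i (pd j u1)) := fun i j => contDiff_pd i (g1 j) (by norm_num)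
  have k1 : ∀ i, ContDiff ℝ 2 (pd i u2) := fun i => contDiff_pd i h2 (by norm_num)
  have cl : Continuous (lap u1) := (contDiff_lap h1 (m := 2) (by norm_num)).continuous
  have w2 := continuous_WW (h2.of_le (by norm_num)) 2 cl
  have w1 := fun i => continuous_WW ((g1 i).of_le (by norm_num)) 2 (k1 i).continuous
  have cu2 := h2.continuous
  have cp := fun i => (g1 i).continuous
  have cD := fun i j => (g2 i j).continuous
  have cg := fun i => (k1 i).continuous
  have ccu2 : Continuous (fun x => conj (u2 x)) := Complex.continuous_conj.comp cu2
  have ccp : ∀ i, Continuous (fun x => conj (pd i u1 x)) := fun i => Complex.continuous_conj.comp (cp i)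
  have a5 : ip5 (WW u1 1 u2, WW u2 2 (lap u1)) (u1, u2) = - ip5 (u1, u2) (u1, u2) := by
    have := zeta_int h1 h2
    unfold ip5
    change (∫ x, zeta (WW u1 1 u2, WW u2 2 (lap u1)) x ∂nu) * _ =
      -((∫ x, zeta (u1, u2) x ∂nu) * _)
    rw [this, neg_mul]
  have I : ∀ {f : E5 → ℂ}, Continuous f → Integrable f nu := fun h => good_nu.integrable h
  have J : ∀ {f : E5 → ℝ}, Continuous f → Integrable f nu := fun h => good_nu.integrable h
  have b := sphere_int cD cg cp w1 cu2 w2 fun x hx =>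
    pointwise hx (fun j k => pd j (pd k u1) x) (fun j => pd j u2 x) (fun j => pd j u1 x) (u2 x)
  have e0 : ∀ w v : (E5 → ℂ) × (E5 → ℂ), (ipT w v).re = 7 * (ip1 w v).re + 3 * (ip2 w v).re +
      (∫ x, w.2 x * conj (v.2 x) ∂nu).re + (∑ i, (∫ x, pd i w.1 x * conj (pd i v.1 x) ∂nu).re)
      + (ip5 w v).re := by
    intro w v
    simp only [ipT, ip3, ip4, Complex.add_re, Complex.re_sum]
    rw [Complex.mul_re]
    simp only [Complex.re_ofNat, Complex.im_ofNat, nu]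
    ring
  rw [e0, e0, a5]
  simp only [d1 h1 h2, Complex.neg_re]
  rw [Finset.sum_add_distrib] at b
  linarith

/-- Corollary 4.6 (Lumer1): `Re (L̃u | u) ≤ −‖u‖²` for all `u = (u₁,u₂)` with
`u₁ ∈ C⁴(cl B⁵;ℂ)`, `u₂ ∈ C³(cl B⁵;ℂ)`. -/
theorem stmt_7 (u : (E5 → ℂ) × (E5 → ℂ))
    (hu1 : ContDiff ℝ 4 u.1) (hu2 : ContDiff ℝ 3 u.2) :
    (ipT (Ltil u) u).re ≤ -(ipT u u).re := by
  rw [Ltil_eq]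
  exact final hu1 hu2

end
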